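/- arXiv:0810.5205 — 3 statements merged into one kernel-verified Lean document; each statement's English description precedes it below -/
import Mathlib

section
/- Let n ≥ 2. If α′ ∈ A_n is obtained from α ∈ A_n by applying one elementary operation E_s or E_c at a negative cell of α (i.e., at an even index), then α < α′ in the lexical order. -/
/-!
Common definitions: α-sequences, the lexical order, elementary operations,
lexical sequences, harmonics, star products, etc.
-/

/-- The sign-alternating sequence `Al(τ)` associated to an α-sequence `τ`
(0-indexed: entry `i` of `Al τ` is `(-1)^i * τ_{i+1}`, and `0` beyond the length). -/
def Al (τ : List ℕ) (i : ℕ) : ℤ := (-1 : ℤ) ^ i * (τ.getD i 0 : ℤ)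

/-- The (strict) lexical order: `τ < τ'` iff the first nonzero entry of
`Al τ - Al τ'` is negative. -/
def lexLt (τ τ' : List ℕ) : Prop :=
  ∃ i, (∀ j < i, Al τ j = Al τ' j) ∧ Al τ i < Al τ' i

/-- An α-sequence: a nonempty finite sequence of positive integers. -/
def IsAlphaSeq (α : List ℕ) : Prop := α ≠ [] ∧ ∀ x ∈ α, 0 < x

/-- `Aset n` is the set `A_n` of α-sequences of degree `n`. -/
def Aset (n : ℕ) : Set (List ℕ) := {α | IsAlphaSeq α ∧ α.sum = n}

/-- Splitting operation `E_s` at the (1-indexed) cell `i`: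
`(α₁,…,α_{i-1}, α_i - 1, 1, α_{i+1},…,α_k)`. -/
def applyEs (α : List ℕ) (i : ℕ) : List ℕ :=
  α.take (i - 1) ++ [α.getD (i - 1) 0 - 1, 1] ++ α.drop i

/-- `E_s` is applicable at cell `i` iff `1 ≤ i ≤ l(α)` and `α_i > 1`. -/
def EsApplicable (α : List ℕ) (i : ℕ) : Prop :=
  1 ≤ i ∧ i ≤ α.length ∧ 1 < α.getD (i - 1) 0

/-- Conjugation operation `E_c` at the (1-indexed) cell `i`:
`(α₁,…,α_{i-2}, α_{i-1} + 1, α_{i+1},…,α_k)`. -/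
def applyEc (α : List ℕ) (i : ℕ) : List ℕ :=
  α.take (i - 2) ++ [α.getD (i - 2) 0 + 1] ++ α.drop i

/-- `E_c` is applicable at cell `i` iff `2 ≤ i ≤ l(α)` and `α_i = 1`. -/
def EcApplicable (α : List ℕ) (i : ℕ) : Prop :=
  2 ≤ i ∧ i ≤ α.length ∧ α.getD (i - 1) 0 = 1

/-- `α'` is obtained from `α` by applying one elementary operation (`E_s` or `E_c`)
at the (1-indexed) cell `i`. -/
def ElemOpAt (α : List ℕ) (i : ℕ) (α' : List ℕ) : Prop :=
  (EsApplicable α i ∧ α' = applyEs α i) ∨ (EcApplicable α i ∧ α' = applyEc α i)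

/-- `a < b` and `a`, `b` are adjacent in `S`: no element of `S` lies strictly between. -/
def AdjLtIn (S : Set (List ℕ)) (a b : List ℕ) : Prop :=
  lexLt a b ∧ ∀ γ ∈ S, ¬ (lexLt a γ ∧ lexLt γ b)

/-- An α-sequence is lexical iff it strictly exceeds all of its proper right sequences. -/
def IsLexical (α : List ℕ) : Prop :=
  IsAlphaSeq α ∧ ∀ i, 2 ≤ i → i ≤ α.length → lexLt (α.drop (i - 1)) α

/-- `Lset n` is the set `L_n` of lexical sequences `α` with `1 + D(α) = n`. -/
def Lset (n : ℕ) : Set (List ℕ) := {α | IsLexical α ∧ 1 + α.sum = n}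

/-- Add `1` to the last entry of a list. -/
def bumpLast (α : List ℕ) : List ℕ := α.dropLast ++ [α.getD (α.length - 1) 0 + 1]

/-- `α_e`: the even-length modification of `α`. -/
def seqE (α : List ℕ) : List ℕ := if Even α.length then bumpLast α else α ++ [1]

/-- `α_o`: the odd-length modification of `α`. -/
def seqO (α : List ℕ) : List ℕ := if Even α.length then α ++ [1] else bumpLast α

/-- The `j`-th harmonicSeq: `h_0(α) = α` and `h_j(α) = (h_{j-1}(α))_o h_{j-1}(α)`. -/
def harmonicSeq : ℕ → List ℕ → List ℕ
  | 0, α => α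
  | j + 1, α => seqO (harmonicSeq j α) ++ harmonicSeq j α

/-- A sequence is fundamental iff it is not a harmonicSeq `h_j(β)`, `j ≥ 1`,
of any α-sequence `β`. -/
def IsFundamental (α : List ℕ) : Prop :=
  ∀ β : List ℕ, IsAlphaSeq β → ∀ j, 1 ≤ j → α ≠ harmonicSeq j β

/-- `α^q`: the `q`-fold concatenation of `α` with itself. -/
def nrep (α : List ℕ) (q : ℕ) : List ℕ := (List.replicate q α).flatten

/-- The star product
`α ⋆ β = α_o (α_e)^{β₁-1} α_o (α_e)^{β₂-1} ⋯ α_o (α_e)^{β_k-1} α`. -/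
def starProd (α β : List ℕ) : List ℕ :=
  (β.map (fun b => seqO α ++ nrep (seqE α) (b - 1))).flatten ++ α

/-- `α ∧ β`: the longest common left factor, ended by the minimum of the
first differing entries. -/
def wedge : List ℕ → List ℕ → List ℕ
  | [], _ => []
  | _, [] => []
  | a :: as, b :: bs => if a = b then a :: wedge as bs else [min a b]

/-- `a` is the least element of `S` in the lexical order. -/
def LeastIn (S : Set (List ℕ)) (a : List ℕ) : Prop :=
  a ∈ S ∧ ∀ b ∈ S, b ≠ a → lexLt a b

/-- `a` is the greatest element of `S` in the lexical order. -/
def GreatestIn (S : Set (List ℕ)) (a : List ℕ) : Prop :=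
  a ∈ S ∧ ∀ b ∈ S, b ≠ a → lexLt b a

/-- `i` is an even (1-indexed) cell of `α` at which the applicable elementary
operation yields a lexical sequence. -/
def GoodEvenIndex (α : List ℕ) (i : ℕ) : Prop :=
  Even i ∧ ∃ α', ElemOpAt α i α' ∧ IsLexical α'

/-- `i` is an odd (1-indexed) cell of `α` at which the applicable elementary
operation yields a lexical sequence. -/
def GoodOddIndex (α : List ℕ) (i : ℕ) : Prop :=
  Odd i ∧ ∃ α', ElemOpAt α i α' ∧ IsLexical α'

/-- The successor operation: apply whichever of `E_s`, `E_c` is applicable at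
the largest even (1-indexed) index `≤ l(α)`, i.e. on the tail of the longest
left sequence of even length. -/
def succOp (α : List ℕ) : List ℕ :=
  let i := if Even α.length then α.length else α.length - 1
  if 1 < α.getD (i - 1) 0 then applyEs α i else applyEc α i

theorem lexLt_take_append_cons {α l : List ℕ} {m x : ℕ} (hm : m ≤ α.length)
    (h : (-1 : ℤ) ^ m * (α.getD m 0 : ℤ) < (-1 : ℤ) ^ m * (x : ℤ)) :
    lexLt α (α.take m ++ x :: l) := by
  have hlen : (α.take m).length = m := by simp [hm]
  refine ⟨m, fun j hj => ?_, ?_⟩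
  · have hj' : j < (α.take m).length := by omega
    simp only [Al, List.getD_eq_getElem?_getD, List.getElem?_append_left hj',
      List.getElem?_take_of_lt hj]
  · have hx : (α.take m ++ x :: l).getD m 0 = x := by
      rw [List.getD_append_right _ _ _ _ hlen.le, hlen]
      simp
    simpa only [Al, hx] using h

/-- an elementary operation at a negative (even 1-indexed) cell
produces a lexical-order successor. -/
theorem stmt_1 (n : ℕ) (hn : 2 ≤ n) (α α' : List ℕ)
    (hα : α ∈ Aset n) (hα' : α' ∈ Aset n)
    (i : ℕ) (hi : Even i) (hop : ElemOpAt α i α') :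
    lexLt α α' := by
  rcases hop with ⟨⟨h1, h2, h3⟩, rfl⟩ | ⟨⟨h1, h2, -⟩, rfl⟩
  · have hodd : Odd (i - 1) := Nat.Even.sub_odd h1 hi odd_one
    rw [applyEs, List.append_assoc]
    refine lexLt_take_append_cons (by omega) ?_
    rw [hodd.neg_one_pow]
    omega
  · have heven : Even (i - 2) := hi.tsub even_two
    rw [applyEc, List.append_assoc]
    refine lexLt_take_append_cons (by omega) ?_
    rw [heven.neg_one_pow]
    omega
end

section
/- Let n ≥ 2 and let α ∈ A_n with l(α) ≥ 2. Let α′ be obtained from α by applying one elementary operation on the tail of the longest left sequence of even length of α, i.e., by applying whichever of E_s, E_c is applicable at the largest even index i ≤ l(α). Then α′ ∈ A_n and α is adjacent to α′ in A_n with α < α′ (α′ is the immediate successor of α in A_n). -/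
theorem Al_cons_zero (a : ℕ) (s : List ℕ) : Al (a :: s) 0 = a := by
  simp [Al]

theorem Al_cons_succ (a : ℕ) (s : List ℕ) (j : ℕ) : Al (a :: s) (j + 1) = -Al s j := by
  simp [Al, pow_succ]

theorem lexLt_irrefl (s : List ℕ) : ¬lexLt s s := fun ⟨_, _, h⟩ => lt_irrefl _ h

theorem lexLt_cons_cons (a b : ℕ) (s t : List ℕ) :
    lexLt (a :: s) (b :: t) ↔ a < b ∨ a = b ∧ lexLt t s := by
  constructor
  · rintro ⟨_ | i, hj, hi⟩
    · left
      simpa [Al_cons_zero] using hi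
    · refine Or.inr ⟨by simpa [Al_cons_zero] using hj 0 (by omega), i, fun j hji => ?_, ?_⟩
      · simpa [Al_cons_succ] using (hj (j + 1) (by omega)).symm
      · simpa [Al_cons_succ] using hi
  · rintro (h | ⟨rfl, i, hj, hi⟩)
    · exact ⟨0, by simp, by simpa [Al_cons_zero] using h⟩
    · refine ⟨i + 1, ?_, by simpa [Al_cons_succ] using hi⟩
      rintro (_ | j) hji
      · simp [Al_cons_zero]
      · simpa [Al_cons_succ] using (hj j (by omega)).symm

/-- `t` immediately follows `s` among the (possibly empty) sequences of positive integers
whose degree is that of `s` and `t`. -/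
def IsNext (s t : List ℕ) : Prop :=
  s.sum = t.sum ∧ lexLt s t ∧
    ∀ γ : List ℕ, (∀ x ∈ γ, 0 < x) → γ.sum = s.sum → ¬(lexLt s γ ∧ lexLt γ t)

theorem IsNext.cons {s t : List ℕ} (h : IsNext s t) {a : ℕ} (ha : 0 < a) :
    IsNext (a :: t) (a :: s) := by
  obtain ⟨hsum, hlt, hno⟩ := h
  refine ⟨by simp [hsum], (lexLt_cons_cons ..).2 (Or.inr ⟨rfl, hlt⟩), ?_⟩
  rintro (_ | ⟨g, δ⟩) hpos hγ ⟨h₁, h₂⟩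
  · simp at hγ
    omega
  · rw [lexLt_cons_cons] at h₁ h₂
    obtain ⟨rfl, h₃, h₄⟩ : a = g ∧ lexLt δ t ∧ lexLt s δ := by grind
    exact hno δ (fun x hx => hpos x (by simp [hx])) (by simp at hγ; omega) ⟨h₄, h₃⟩

theorem IsNext.append {s t : List ℕ} (h : IsNext s t) (p : List ℕ) (hp : ∀ x ∈ p, 0 < x) :
    (Even p.length → IsNext (p ++ s) (p ++ t)) ∧
      (Odd p.length → IsNext (p ++ t) (p ++ s)) := by
  induction p with
  | nil => simpa using h
  | cons a p ih =>
    obtain ⟨he, ho⟩ := ih fun x hx => hp x (by simp [hx])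
    have ha : 0 < a := hp a (by simp)
    constructor <;> intro hl
    · exact (ho (by simpa [Nat.even_add_one] using hl)).cons ha
    · exact (he (by simpa [Nat.odd_add_one] using hl)).cons ha

theorem not_lexLt_of_length_le_one {t : List ℕ} (ht : t.length ≤ 1) {γ : List ℕ}
    (hpos : ∀ x ∈ γ, 0 < x) (hsum : γ.sum = t.sum) : ¬lexLt t γ := by
  have eq_nil : ∀ δ : List ℕ, (∀ x ∈ δ, 0 < x) → δ.sum = 0 → δ = [] := by
    rintro (_ | ⟨g, δ⟩) hδ h
    · rfl
    · have := hδ g (by simp)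
      simp at h
      omega
  match t, γ with
  | [], γ =>
    rw [eq_nil γ hpos (by simpa using hsum)]
    exact lexLt_irrefl _
  | [d], [] =>
    simp at hsum
    subst hsum
    rintro ⟨_ | i, -, h⟩ <;> simp [Al] at h
  | [d], g :: δ =>
    simp at hsum
    rw [lexLt_cons_cons]
    rintro (h | ⟨rfl, h⟩)
    · omega
    · rw [eq_nil δ (fun x hx => hpos x (by simp [hx])) (by omega)] at h
      exact lexLt_irrefl _ h
  | _ :: _ :: _, _ => simp at ht

theorem isNext_conjugate (b : ℕ) {t : List ℕ} (ht : t.length ≤ 1) :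
    IsNext (b :: 1 :: t) ((b + 1) :: t) := by
  refine ⟨by simp; omega, (lexLt_cons_cons ..).2 (Or.inl (by omega)), ?_⟩
  rintro (_ | ⟨g, δ⟩) hpos hγ ⟨h₁, h₂⟩
  · simp at hγ
    omega
  have hδ : ∀ x ∈ δ, 0 < x := fun x hx => hpos x (by simp [hx])
  simp at hγ
  rw [lexLt_cons_cons] at h₁ h₂
  have hcases : g = b + 1 ∧ lexLt t δ ∨ g = b ∧ lexLt δ (1 :: t) := by grind
  rcases hcases with ⟨rfl, h⟩ | ⟨rfl, h⟩
  · exact not_lexLt_of_length_le_one ht hδ (by omega) h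
  · rcases δ with _ | ⟨e, ε⟩
    · simp at hγ
    · have he := hδ e (by simp)
      rw [lexLt_cons_cons] at h
      simp at hγ
      rcases h with h | ⟨rfl, h⟩
      · omega
      · exact not_lexLt_of_length_le_one ht (fun x hx => hδ x (by simp [hx])) (by omega) h

theorem IsNext.adjLtIn {n : ℕ} {s t : List ℕ} (h : IsNext s t) (hs : s.sum = n) :
    AdjLtIn (Aset n) s t :=
  ⟨h.2.1, fun γ hγ => h.2.2 γ hγ.1.2 (hγ.2.trans hs.symm)⟩

/-- applying an elementary operation on the tail of the longest left
sequence of even length (the largest even index `≤ l(α)`) gives the immediate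
successor of `α` in `A_n`. -/
theorem stmt_3 (n : ℕ) (hn : 2 ≤ n) (α : List ℕ) (hα : α ∈ Aset n)
    (hlen : 2 ≤ α.length)
    (i : ℕ) (hi : i = if Even α.length then α.length else α.length - 1)
    (α' : List ℕ) (hop : ElemOpAt α i α') :
    α' ∈ Aset n ∧ AdjLtIn (Aset n) α α' := by
  obtain ⟨⟨-, hpos⟩, hsum⟩ := hα
  have hieven : Even i := by grind
  have htail : (α.drop i).length ≤ 1 := by
    rw [List.length_drop]
    split_ifs at hi <;> omega
  have htake : ∀ m, ∀ x ∈ α.take m, 0 < x := fun m x hx => hpos x (List.mem_of_mem_take hx)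
  have hdrop : ∀ x ∈ α.drop i, 0 < x := fun x hx => hpos x (List.mem_of_mem_drop hx)
  have key : (∀ x ∈ α', 0 < x) ∧ α' ≠ [] ∧ IsNext α α' := by
    rcases hop with ⟨⟨h1, h2, h3⟩, rfl⟩ | ⟨⟨h1, h2, h3⟩, rfl⟩
    · obtain ⟨j, rfl⟩ : ∃ j, i = j + 1 := ⟨i - 1, by omega⟩
      simp only [applyEs, Nat.add_sub_cancel] at h3 ⊢
      have hj : j < α.length := by omega
      rw [List.getD_eq_getElem _ _ hj] at h3 ⊢
      have hsplit : α = α.take j ++ (α[j] - 1 + 1) :: α.drop (j + 1) := by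
        rw [Nat.sub_add_cancel h3.le, ← List.drop_eq_getElem_cons hj, List.take_append_drop]
      refine ⟨by grind, by simp, ?_⟩
      have := ((isNext_conjugate (α[j] - 1) htail).append _ (htake j)).2 (by grind)
      rw [← hsplit] at this
      simpa using this
    · obtain ⟨j, rfl⟩ : ∃ j, i = j + 2 := ⟨i - 2, by omega⟩
      simp only [applyEc, Nat.add_sub_cancel, Nat.add_succ_sub_one] at h3 ⊢
      have hj : j < α.length := by omega
      have hj' : j + 1 < α.length := by omega
      rw [List.getD_eq_getElem _ _ hj'] at h3
      rw [List.getD_eq_getElem _ _ hj]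
      have hsplit : α = α.take j ++ α[j] :: 1 :: α.drop (j + 2) := by
        rw [← h3, ← List.drop_eq_getElem_cons hj', ← List.drop_eq_getElem_cons hj,
          List.take_append_drop]
      refine ⟨by grind, by simp, ?_⟩
      have := ((isNext_conjugate α[j] htail).append _ (htake j)).1 (by grind)
      rw [← hsplit] at this
      simpa using this
  obtain ⟨hpos', hne, hnext⟩ := key
  exact ⟨⟨⟨hne, hpos'⟩, hnext.1.symm.trans hsum⟩, hnext.adjLtIn hsum⟩
end

section
/- Let n ≥ 2. If α and α′ are adjacent in A_n, then l(α) and l(α′) have opposite parity. -/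
theorem lexLt_cons_iff (a b : ℕ) (s t : List ℕ) :
    lexLt (a :: s) (b :: t) ↔ a < b ∨ (a = b ∧ lexLt t s) := by
  have h0 : ∀ (c : ℕ) (r : List ℕ), Al (c :: r) 0 = c := by simp [Al]
  have hs : ∀ (c : ℕ) (r : List ℕ) (i : ℕ), Al (c :: r) (i + 1) = -Al r i := by
    intro c r i
    simp [Al, pow_succ]
  constructor
  · rintro ⟨i, hi, hlt⟩
    cases i with
    | zero =>
      left
      simpa [h0] using hlt
    | succ i =>
      right
      refine ⟨by simpa [h0] using hi 0 (Nat.succ_pos i), i, fun j hj => ?_, ?_⟩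
      · have := hi (j + 1) (by omega)
        rw [hs, hs] at this
        omega
      · rw [hs, hs] at hlt
        omega
  · rintro (h | ⟨rfl, i, hi, hlt⟩)
    · exact ⟨0, by simp, by simpa [h0] using h⟩
    · refine ⟨i + 1, fun j hj => ?_, ?_⟩
      · cases j with
        | zero => rw [h0, h0]
        | succ j => rw [hs, hs, hi j (by omega)]
      · rw [hs, hs]
        omega

theorem not_lexLt_self (s : List ℕ) : ¬ lexLt s s := fun ⟨_, _, h⟩ => lt_irrefl _ h

theorem eq_nil_of_pos_of_sum_eq_zero {s : List ℕ} (hs : ∀ x ∈ s, 0 < x) (h : s.sum = 0) :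
    s = [] := by
  cases s with
  | nil => rfl
  | cons a s =>
    have := hs a (by simp)
    simp only [List.sum_cons] at h
    omega

/-- Among sequences of positive integers with a given sum, there is a lexically greatest one,
of length at most one. -/
theorem exists_lexLt_greatest (k : ℕ) :
    ∃ u : List ℕ, (∀ x ∈ u, 0 < x) ∧ u.sum = k ∧
      ∀ t : List ℕ, (∀ x ∈ t, 0 < x) → t.sum = k → t ≠ u → lexLt t u := by
  rcases Nat.eq_zero_or_pos k with rfl | hk
  · exact ⟨[], by simp, by simp, fun t ht hsum hne =>
      absurd (eq_nil_of_pos_of_sum_eq_zero ht hsum) hne⟩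
  · refine ⟨[k], by simpa using hk, by simp, fun t ht hsum hne => ?_⟩
    cases t with
    | nil =>
      simp only [List.sum_nil] at hsum
      omega
    | cons a t =>
      rw [List.sum_cons] at hsum
      rw [lexLt_cons_iff]
      left
      by_contra hak
      have ht0 := eq_nil_of_pos_of_sum_eq_zero (s := t) (fun x hx => ht x (by simp [hx]))
        (by omega)
      subst ht0
      exact hne (by simpa using hsum)

theorem length_parity_ne_of_adjacent (α β : List ℕ) (hα : ∀ x ∈ α, 0 < x)
    (hβ : ∀ x ∈ β, 0 < x) (hsum : α.sum = β.sum) (hlt : lexLt α β)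
    (hadj : ∀ γ : List ℕ, (∀ x ∈ γ, 0 < x) → γ.sum = α.sum → ¬ (lexLt α γ ∧ lexLt γ β)) :
    α.length % 2 ≠ β.length % 2 := by
  cases α with
  | nil =>
    rw [eq_nil_of_pos_of_sum_eq_zero hβ (by simpa using hsum.symm)] at hlt
    exact absurd hlt (not_lexLt_self _)
  | cons a s =>
    cases β with
    | nil =>
      rw [eq_nil_of_pos_of_sum_eq_zero hα (by simpa using hsum)] at hlt
      exact absurd hlt (not_lexLt_self _)
    | cons b t =>
      have ha : 0 < a := hα a (by simp)
      have hs : ∀ x ∈ s, 0 < x := fun x hx => hα x (by simp [hx])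
      have ht : ∀ x ∈ t, 0 < x := fun x hx => hβ x (by simp [hx])
      simp only [List.sum_cons] at hsum hadj
      rcases (lexLt_cons_iff a b s t).1 hlt with hab | ⟨rfl, hts⟩
      · cases s with
        | nil =>
          simp only [List.sum_nil] at hsum
          omega
        | cons c r =>
          have hc : 0 < c := hs c (by simp)
          have hr : ∀ x ∈ r, 0 < x := fun x hx => hs x (by simp [hx])
          simp only [List.sum_cons] at hsum hadj
          obtain ⟨u, hu, husum, hmax⟩ := exists_lexLt_greatest (c + r.sum - 1)
          have hleft := hadj (a :: 1 :: u) (by simpa [ha] using hu)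
            (by simp only [List.sum_cons]; omega)
          have hright := hadj ((a + 1) :: u) (by simpa using hu)
            (by simp only [List.sum_cons]; omega)
          simp only [lexLt_cons_iff] at hleft hright
          have hc1 : c = 1 := by
            by_contra hne
            exact hleft ⟨Or.inr ⟨trivial, Or.inl (by omega)⟩, Or.inl hab⟩
          have hb : b = a + 1 := by
            by_contra hne
            exact hright ⟨Or.inl (by omega), Or.inl (by omega)⟩
          have hru : r = u := by
            by_contra hne
            exact hleft ⟨Or.inr ⟨trivial, Or.inr ⟨hc1.symm, hmax r hr (by omega) hne⟩⟩, Or.inl hab⟩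
          have htu : t = u := by
            by_contra hne
            exact hright ⟨Or.inl (by omega), Or.inr ⟨hb.symm, hmax t ht (by omega) hne⟩⟩
          subst hru htu
          simp only [List.length_cons]
          omega
      · have hswap : ∀ γ : List ℕ, (∀ x ∈ γ, 0 < x) → γ.sum = t.sum →
            ¬ (lexLt t γ ∧ lexLt γ s) := by
          rintro γ hγ hγsum ⟨h1, h2⟩
          refine hadj (a :: γ) (by simpa [ha] using hγ) (by simp only [List.sum_cons]; omega) ?_
          simp only [lexLt_cons_iff]
          exact ⟨Or.inr ⟨trivial, h2⟩, Or.inr ⟨trivial, h1⟩⟩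
        have hpar := length_parity_ne_of_adjacent t s ht hs (by omega) hts hswap
        simp only [List.length_cons]
        omega
termination_by α.length + β.length

/-- adjacent sequences in `A_n` have lengths of opposite parity. -/
theorem stmt_5 (n : ℕ) (hn : 2 ≤ n) (α α' : List ℕ)
    (hα : α ∈ Aset n) (hα' : α' ∈ Aset n)
    (hadj : AdjLtIn (Aset n) α α' ∨ AdjLtIn (Aset n) α' α) :
    α.length % 2 ≠ α'.length % 2 := by
  have key : ∀ β β' : List ℕ, β ∈ Aset n → β' ∈ Aset n → AdjLtIn (Aset n) β β' →
      β.length % 2 ≠ β'.length % 2 := by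
    rintro β β' ⟨⟨-, hβ⟩, hsum⟩ ⟨⟨-, hβ'⟩, hsum'⟩ ⟨hlt, hno⟩
    refine length_parity_ne_of_adjacent β β' hβ hβ' (hsum.trans hsum'.symm) hlt
      fun γ hγ hγsum => hno γ ⟨⟨?_, hγ⟩, hγsum.trans hsum⟩
    rintro rfl
    simp only [List.sum_nil] at hγsum
    omega
  rcases hadj with h | h
  · exact key α α' hα hα' h
  · exact (key α' α hα' hα h).symm
end
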